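/- Let a ∈ [−∞, 0) and let (H, φ) solve the EdGB FLRW system on (a, 0] with the negative-branch initial data with parameter β. Then for all t ∈ (a, 0): (i) H(t) < min{ (e^{6γt}·(1/β^2 − 4β/(5γ) + 2θ/(15γ^2)) − 2(−6βγ + θ + 6γθt)/(15γ^2))^{−1/2}, γ/(1 − 3β^3 t) }; (ii) H(t) > [β^{−1/4} − (β^{−1/4}/(4(m+1)))·(1 − (1 − 3β^3 t)^{m+1})]^{−4} > 0; (iii) ln((1 − 3β^3 t)^2) < φ(t) < (√6·γ/(3β^3))·ln(1 − 3β^3 t) + (2β^3/(4γ + β^3))·((1 − 3β^3 t)^{(4γ + β^3)/β^3} − 1). -/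

import Mathlib

/-- The EdGB FLRW system on a set `I ⊆ ℝ`: `H` is continuously differentiable and
`φ` twice continuously differentiable on `I`, and for every `t ∈ I` the Hamiltonian
constraint `3H² − 3e^φ φ' H³ = φ'²/2` and the scalar field equation
`φ'' = −3Hφ' − 3e^φ H²(H² + H')` hold. -/
def EdGB (H φ : ℝ → ℝ) (I : Set ℝ) : Prop :=
  ContDiffOn ℝ 1 H I ∧ ContDiffOn ℝ 2 φ I ∧
  (∀ t ∈ I, 3 * H t ^ 2 - 3 * Real.exp (φ t) * deriv φ t * H t ^ 3 = (deriv φ t) ^ 2 / 2) ∧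
  (∀ t ∈ I, deriv (deriv φ) t =
      -3 * H t * deriv φ t - 3 * Real.exp (φ t) * H t ^ 2 * (H t ^ 2 + deriv H t))

/-- The negative-branch initial data with parameter `β`:
`H(0) = β`, `φ(0) = 0`, `φ'(0) = −3β³ − √(9β⁶ + 6β²)`, with `0 < β < √6/6`. -/
def NegBranchData (H φ : ℝ → ℝ) (β : ℝ) : Prop :=
  0 < β ∧ β < Real.sqrt 6 / 6 ∧ H 0 = β ∧ φ 0 = 0 ∧
  deriv φ 0 = -3 * β ^ 3 - Real.sqrt (9 * β ^ 6 + 6 * β ^ 2)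

noncomputable section

/-- `γ = (3β³ + √(9β⁶+12))/2`. -/
def gammaβ (β : ℝ) : ℝ := (3 * β ^ 3 + Real.sqrt (9 * β ^ 6 + 12)) / 2

/-- `θ = 2(9β⁶ + β³√(9β⁶+12))/(√(9β⁶+12) + 3β³)²`. -/
def thetaβ (β : ℝ) : ℝ :=
  2 * (9 * β ^ 6 + β ^ 3 * Real.sqrt (9 * β ^ 6 + 12)) /
    (Real.sqrt (9 * β ^ 6 + 12) + 3 * β ^ 3) ^ 2

/-- `m = (107√(9β⁶+12) + 309β³)/(60β³)`. -/
def mβ (β : ℝ) : ℝ := (107 * Real.sqrt (9 * β ^ 6 + 12) + 309 * β ^ 3) / (60 * β ^ 3)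

/-- The upper bound for `H` on the past evolution. -/
def Hupper (β t : ℝ) : ℝ :=
  min ((Real.exp (6 * gammaβ β * t) *
        (1 / β ^ 2 - 4 * β / (5 * gammaβ β) + 2 * thetaβ β / (15 * (gammaβ β) ^ 2)) -
      2 * (-6 * β * gammaβ β + thetaβ β + 6 * gammaβ β * thetaβ β * t) /
        (15 * (gammaβ β) ^ 2)) ^ (-(1 / 2) : ℝ))
    (gammaβ β / (1 - 3 * β ^ 3 * t))

/-- The lower bound for `H` on the past evolution. -/
def Hlower (β t : ℝ) : ℝ :=
  (β ^ (-(1 / 4) : ℝ) -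
      β ^ (-(1 / 4) : ℝ) / (4 * (mβ β + 1)) *
        (1 - (1 - 3 * β ^ 3 * t) ^ (mβ β + 1))) ^ (-4 : ℝ)

/-- The upper bound for `φ` on the past evolution. -/
def phiupper (β t : ℝ) : ℝ :=
  Real.sqrt 6 * gammaβ β / (3 * β ^ 3) * Real.log (1 - 3 * β ^ 3 * t) +
    2 * β ^ 3 / (4 * gammaβ β + β ^ 3) *
      ((1 - 3 * β ^ 3 * t) ^ ((4 * gammaβ β + β ^ 3) / β ^ 3) - 1)

end

/-- A function on `(T, 0]` with negative derivative on `(T, 0)` exceeds its final value. -/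
lemma lt_of_hasDerivAt_neg {T b : ℝ} {f f' : ℝ → ℝ} (hc : ContinuousOn f (Set.Ioc T b))
    (hd : ∀ t ∈ Set.Ioo T b, HasDerivAt f (f' t) t) (hneg : ∀ t ∈ Set.Ioo T b, f' t < 0)
    {t : ℝ} (ht : t ∈ Set.Ioo T b) : f b < f t := by
  have hanti : StrictAntiOn f (Set.Ioc T b) := by
    refine strictAntiOn_of_deriv_neg (convex_Ioc T b) hc ?_
    intro x hx
    rw [interior_Ioc] at hx
    rw [(hd x hx).deriv]
    exact hneg x hx
  exact hanti ⟨ht.1, ht.2.le⟩ ⟨ht.1.trans ht.2, le_rfl⟩ ht.2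

/-- A function on `(T, b]` with positive derivative on `(T, b)` lies below its final value. -/
lemma lt_of_hasDerivAt_pos {T b : ℝ} {f f' : ℝ → ℝ} (hc : ContinuousOn f (Set.Ioc T b))
    (hd : ∀ t ∈ Set.Ioo T b, HasDerivAt f (f' t) t) (hpos : ∀ t ∈ Set.Ioo T b, 0 < f' t)
    {t : ℝ} (ht : t ∈ Set.Ioo T b) : f t < f b := by
  have := lt_of_hasDerivAt_neg (f := fun s => -f s) (f' := fun s => -f' s) hc.neg
    (fun s hs => (hd s hs).neg) (fun s hs => neg_lt_zero.2 (hpos s hs)) ht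
  linarith

/-- The algebraic relations between `u = e^φ H²`, `p = -φ'/H` and `h = H'/H²` on the
negative branch. -/
structure NegBranchRel (u p h : ℝ) : Prop where
  u_pos : 0 < u
  p_pos : 0 < p
  p_sq : p ^ 2 = 6 * u * p + 6
  h_eq : h * (2 + 2 * u * p + 3 * u ^ 2) =
    6 * u ^ 2 * p + 6 * u - 3 * u ^ 2 - 2 * u * p - 6

namespace NegBranchRel

variable {u p h : ℝ}

lemma den_pos (R : NegBranchRel u p h) : 0 < 2 + 2 * u * p + 3 * u ^ 2 := by
  have := R.u_pos
  have := R.p_pos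
  positivity

lemma six_mul_lt (R : NegBranchRel u p h) : 6 * u < p := by
  have := R.p_pos
  have h2 := R.p_sq
  nlinarith

lemma two_lt (R : NegBranchRel u p h) : 2 < p := by
  nlinarith [R.p_pos, R.p_sq, mul_pos R.u_pos R.p_pos]

lemma lt_add_sqrt (R : NegBranchRel u p h) : p < 6 * u + √6 := by
  have h6 : 0 < √6 := by positivity
  have hs : √6 ^ 2 = 6 := Real.sq_sqrt (by norm_num)
  by_contra! hcon
  nlinarith [R.p_pos, R.p_sq, R.u_pos, mul_pos R.u_pos h6]

lemma two_mul_lt (R : NegBranchRel u p h) : 2 * h < p := by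
  have hD := R.den_pos
  have hu := R.u_pos
  have hp := R.p_pos
  have key : 0 < (p - 2 * h) * (2 + 2 * u * p + 3 * u ^ 2) := by
    have e : (p - 2 * h) * (2 + 2 * u * p + 3 * u ^ 2) =
        2 * p + 3 * u ^ 2 * p + 6 * u ^ 2 + 4 * u * p + 12 := by
      linear_combination 2 * u * R.p_sq - 2 * R.h_eq
    rw [e]
    positivity
  linarith [(mul_pos_iff_of_pos_right hD).1 key]

lemma le_h (R : NegBranchRel u p h) : 12 / 5 * u - 3 ≤ h := by
  have hD := R.den_pos
  have hu := R.u_pos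
  have hp := R.p_pos
  have key : 0 < (h - (12 / 5 * u - 3)) * (2 + 2 * u * p + 3 * u ^ 2) := by
    have e : (h - (12 / 5 * u - 3)) * (2 + 2 * u * p + 3 * u ^ 2) =
        6 / 5 * u ^ 2 * (p - 6 * u) + 6 / 5 * u + 6 * u ^ 2 + 4 * (u * p) := by
      linear_combination R.h_eq
    rw [e]
    have : 0 < p - 6 * u := sub_pos.2 R.six_mul_lt
    positivity
  linarith [(mul_pos_iff_of_pos_right hD).1 key]

lemma h_le (R : NegBranchRel u p h) : h ≤ 12 / 5 * u := by
  have hD := R.den_pos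
  have hu := R.u_pos
  have hp := R.p_pos
  have h6 := R.six_mul_lt
  have key : 0 < (12 / 5 * u - h) * (2 + 2 * u * p + 3 * u ^ 2) := by
    have e : (12 / 5 * u - h) * (2 + 2 * u * p + 3 * u ^ 2) =
        3 * u ^ 2 + 2 * u * p + 6 - 6 / 5 * u - 6 / 5 * (u * (u * (p - 6 * u))) := by
      linear_combination -R.h_eq
    rw [e]
    have h1 : u * (p - 6 * u) ≤ 1 := by nlinarith [R.p_sq]
    nlinarith [mul_le_mul_of_nonneg_left h1 hu.le, R.two_lt, mul_pos hu hp]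
  linarith [(mul_pos_iff_of_pos_right hD).1 key]

lemma sub_le (R : NegBranchRel u p h) : p - 11 / 4 * h ≤ 107 / 10 - 3 / 5 * u := by
  have hD := R.den_pos
  have hu := R.u_pos
  have hp := R.p_pos
  have h6 := R.six_mul_lt
  have hs : √6 < 2.45 := by
    rw [Real.sqrt_lt' (by norm_num)]; norm_num
  have key : 0 < (107 / 10 - 3 / 5 * u - (p - 11 / 4 * h)) * (2 + 2 * u * p + 3 * u ^ 2) := by
    have e : (107 / 10 - 3 / 5 * u - (p - 11 / 4 * h)) * (2 + 2 * u * p + 3 * u ^ 2) =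
        49 / 10 - 2 * p + 33 / 10 * u + 159 / 10 * (u * p) + 477 / 20 * u ^ 2
          + 3 / 10 * u ^ 2 * (p - 6 * u) := by
      linear_combination 11 / 4 * R.h_eq - 2 * u * R.p_sq
    rw [e]
    have h1 : 0 < u ^ 2 * (p - 6 * u) := mul_pos (by positivity) (sub_pos.2 h6)
    nlinarith [R.lt_add_sqrt, R.two_lt, mul_lt_mul_of_pos_left R.two_lt hu]
  linarith [(mul_pos_iff_of_pos_right hD).1 key]

end NegBranchRel

lemma sqrt_three_lt_gammaβ {β : ℝ} (hβ : 0 < β) : √3 < gammaβ β := by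
  have h3 : 0 < β ^ 3 := by positivity
  have h1 : √12 ≤ √(9 * β ^ 6 + 12) := Real.sqrt_le_sqrt (by nlinarith [pow_pos hβ 6])
  have h2 : √12 = 2 * √3 := by
    rw [show (12 : ℝ) = 2 ^ 2 * 3 by norm_num, Real.sqrt_mul (by norm_num),
      Real.sqrt_sq (by norm_num)]
  unfold gammaβ
  linarith

lemma three_half_lt_gammaβ {β : ℝ} (hβ : 0 < β) : 3 / 2 < gammaβ β := by
  have : (3 / 2 : ℝ) < √3 := by
    rw [Real.lt_sqrt (by norm_num)]; norm_num
  exact this.trans (sqrt_three_lt_gammaβ hβ)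

lemma thetaβ_eq {β : ℝ} (hβ : 0 < β) :
    thetaβ β = β ^ 3 * (gammaβ β + 3 * β ^ 3) / gammaβ β ^ 2 := by
  have h0 := three_half_lt_gammaβ hβ
  have hs : √(9 * β ^ 6 + 12) = 2 * gammaβ β - 3 * β ^ 3 := by unfold gammaβ; ring
  unfold thetaβ
  rw [hs]
  have : gammaβ β ≠ 0 := by positivity
  have e : 2 * gammaβ β - 3 * β ^ 3 + 3 * β ^ 3 = 2 * gammaβ β := by ring
  rw [e]
  field_simp
  ring

lemma mβ_eq {β : ℝ} (hβ : 0 < β) :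
    3 * β ^ 3 * mβ β = 107 / 10 * gammaβ β - 3 / 5 * β ^ 3 := by
  have hs : √(9 * β ^ 6 + 12) = 2 * gammaβ β - 3 * β ^ 3 := by unfold gammaβ; ring
  unfold mβ
  rw [hs]
  field_simp
  ring

lemma mβ_pos {β : ℝ} (hβ : 0 < β) : 0 < mβ β := by
  unfold mβ; positivity

lemma lt_half_of_lt_sqrt {β : ℝ} (h : β < √6 / 6) : β < 1 / 2 := by
  have : √6 < 3 := by rw [Real.sqrt_lt' (by norm_num)]; norm_num
  linarith

lemma thetaβ_nonneg {β : ℝ} (hβ : 0 < β) : 0 ≤ thetaβ β := by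
  unfold thetaβ; positivity

lemma thetaβ_lt {β : ℝ} (hβ : 0 < β) (hβ' : β < 1 / 2) : thetaβ β < β ^ 2 := by
  have h0 := three_half_lt_gammaβ hβ
  rw [thetaβ_eq hβ, div_lt_iff₀ (by positivity)]
  have h2 : 0 < β ^ 2 := by positivity
  have h3 : β ^ 3 < 1 / 8 := by
    calc β ^ 3 < (1 / 2) ^ 3 := pow_lt_pow_left₀ hβ' hβ.le (by norm_num)
      _ = 1 / 8 := by norm_num
  have : β * (gammaβ β + 3 * β ^ 3) < gammaβ β ^ 2 := by
    nlinarith [pow_pos hβ 3]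
  nlinarith

/-- A solution on `(T, 0]` with `H > 0` on the negative branch, in terms of
`p = -φ'/H` and `h = H'/H²`. -/
structure PastSolution (T β : ℝ) (H φ p h : ℝ → ℝ) : Prop where
  β_pos : 0 < β
  β_lt : β < 1 / 2
  contH : ContinuousOn H (Set.Ioc T 0)
  contφ : ContinuousOn φ (Set.Ioc T 0)
  H_pos : ∀ t ∈ Set.Ioc T 0, 0 < H t
  H_zero : H 0 = β
  φ_zero : φ 0 = 0
  derivφ : ∀ t ∈ Set.Ioo T 0, HasDerivAt φ (-(H t * p t)) t
  derivH : ∀ t ∈ Set.Ioo T 0, HasDerivAt H (H t ^ 2 * h t) t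
  rel : ∀ t ∈ Set.Ioo T 0, NegBranchRel (Real.exp (φ t) * H t ^ 2) (p t) (h t)

namespace PastSolution

variable {T β : ℝ} {H φ p h : ℝ → ℝ}

lemma Ho (S : PastSolution T β H φ p h) {t : ℝ} (ht : t ∈ Set.Ioo T 0) : 0 < H t :=
  S.H_pos t ⟨ht.1, ht.2.le⟩

lemma cont_u (S : PastSolution T β H φ p h) :
    ContinuousOn (fun t => Real.exp (φ t) * H t ^ 2) (Set.Ioc T 0) :=
  S.contφ.rexp.mul (S.contH.pow 2)

lemma deriv_u (S : PastSolution T β H φ p h) {t : ℝ} (ht : t ∈ Set.Ioo T 0) :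
    HasDerivAt (fun t => Real.exp (φ t) * H t ^ 2)
      (Real.exp (φ t) * H t ^ 2 * H t * (2 * h t - p t)) t := by
  refine ((S.derivφ t ht).exp.mul ((S.derivH t ht).pow 2)).congr_deriv ?_
  simp only [Pi.pow_apply]
  push_cast
  ring

lemma deriv_u_neg (S : PastSolution T β H φ p h) {t : ℝ} (ht : t ∈ Set.Ioo T 0) :
    Real.exp (φ t) * H t ^ 2 * H t * (2 * h t - p t) < 0 := by
  have := S.Ho ht
  exact mul_neg_of_pos_of_neg (by positivity) (sub_neg.2 (S.rel t ht).two_mul_lt)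

lemma lt_u (S : PastSolution T β H φ p h) {t : ℝ} (ht : t ∈ Set.Ioo T 0) :
    β ^ 2 < Real.exp (φ t) * H t ^ 2 := by
  have := lt_of_hasDerivAt_neg S.cont_u (fun s hs => S.deriv_u hs)
    (fun s hs => S.deriv_u_neg hs) ht
  simpa [S.H_zero, S.φ_zero] using this

lemma one_lt_r (S : PastSolution T β H φ p h) {t : ℝ} (ht : t ∈ Set.Ioo T 0) :
    1 < 1 - 3 * β ^ 3 * t := by
  have := mul_pos (pow_pos S.β_pos 3) (neg_pos.2 ht.2)
  linarith

lemma lt_exp_half (S : PastSolution T β H φ p h) {t : ℝ} (ht : t ∈ Set.Ioo T 0) :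
    1 - 3 * β ^ 3 * t < Real.exp (φ t / 2) := by
  have key := lt_of_hasDerivAt_neg (f := fun t => Real.exp (φ t / 2) + 3 * β ^ 3 * t)
    (f' := fun t => Real.exp (φ t / 2) * (-(H t * p t) / 2) + 3 * β ^ 3)
    ((S.contφ.div_const 2).rexp.add (by fun_prop))
    (fun s hs => ((S.derivφ s hs).div_const 2).exp.add
      (by simpa using (hasDerivAt_id s).const_mul (3 * β ^ 3))) ?_ ht
  · simp only [S.φ_zero, zero_div, Real.exp_zero, mul_zero, add_zero] at key
    linarith
  · intro s hs
    have hH := S.Ho hs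
    have hb := S.β_pos
    have hE : Real.exp (φ s) = Real.exp (φ s / 2) ^ 2 := by
      rw [← Real.exp_nat_mul]; congr 1; push_cast; ring
    have hu := S.lt_u hs
    have h6 := (S.rel s hs).six_mul_lt
    rw [hE] at hu h6
    have hx : 0 < Real.exp (φ s / 2) := Real.exp_pos _
    set x := Real.exp (φ s / 2)
    have hw : β < x * H s := by
      have : 0 < x * H s := by positivity
      nlinarith
    have hw3 : β ^ 3 < (x * H s) ^ 3 := pow_lt_pow_left₀ hw hb.le (by norm_num)
    have := mul_lt_mul_of_pos_left h6 (mul_pos hx hH)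
    nlinarith

lemma log_lt_φ (S : PastSolution T β H φ p h) {t : ℝ} (ht : t ∈ Set.Ioo T 0) :
    Real.log ((1 - 3 * β ^ 3 * t) ^ 2) < φ t := by
  have h1 := S.one_lt_r ht
  have h2 := (Real.log_lt_iff_lt_exp (by linarith)).2 (S.lt_exp_half ht)
  rw [Real.log_pow]
  push_cast
  linarith

lemma hasDerivAt_r (β s : ℝ) :
    HasDerivAt (fun t => 1 - 3 * β ^ 3 * t) (-(3 * β ^ 3)) s := by
  simpa using ((hasDerivAt_id s).const_mul (3 * β ^ 3)).const_sub 1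

lemma H_lt (S : PastSolution T β H φ p h) {t : ℝ} (ht : t ∈ Set.Ioo T 0) :
    H t < gammaβ β / (1 - 3 * β ^ 3 * t) := by
  have hb := S.β_pos
  have hg := three_half_lt_gammaβ hb
  have small : ∀ s ∈ Set.Ioo T 0, Real.exp (φ s) * H s ^ 2 ≤ 2 →
      (1 - 3 * β ^ 3 * s) / gammaβ β < (H s)⁻¹ := by
    intro s hs hu
    have hH := S.Ho hs
    have h1 := S.one_lt_r hs
    have h2 := S.lt_exp_half hs
    have hE : Real.exp (φ s) = Real.exp (φ s / 2) ^ 2 := by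
      rw [← Real.exp_nat_mul]; congr 1; push_cast; ring
    rw [hE] at hu
    have h3 : (1 - 3 * β ^ 3 * s) * H s < Real.exp (φ s / 2) * H s :=
      mul_lt_mul_of_pos_right h2 hH
    have h4 : Real.exp (φ s / 2) * H s < gammaβ β := by
      have : 0 < Real.exp (φ s / 2) * H s := by positivity
      nlinarith
    rw [div_lt_iff₀ (by linarith), inv_mul_eq_div, lt_div_iff₀ hH]
    exact h3.trans h4
  have main : (1 - 3 * β ^ 3 * t) / gammaβ β < (H t)⁻¹ := by
    by_cases hu : Real.exp (φ t) * H t ^ 2 ≤ 2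
    · exact small t ht hu
    push Not at hu
    have hsub : Set.Icc t 0 ⊆ Set.Ioc T 0 := fun s hs => ⟨ht.1.trans_le hs.1, hs.2⟩
    obtain ⟨b, hb1, hb2⟩ := intermediate_value_Icc' ht.2.le (S.cont_u.mono hsub)
      (show (2 : ℝ) ∈ Set.Icc _ _ by
        refine ⟨?_, hu.le⟩
        simp only [S.φ_zero, S.H_zero, Real.exp_zero]
        nlinarith [S.β_lt])
    have hb0 : b < 0 := by
      refine lt_of_le_of_ne hb1.2 ?_
      rintro rfl
      simp only [S.φ_zero, S.H_zero, Real.exp_zero] at hb2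
      nlinarith [S.β_lt]
    have htb : t < b := by
      refine lt_of_le_of_ne hb1.1 ?_
      rintro rfl
      linarith
    have hbT : b ∈ Set.Ioo T 0 := ⟨ht.1.trans htb, hb0⟩
    have hs1 := small b hbT hb2.le
    have hsub2 : Set.Ioc T b ⊆ Set.Ioc T 0 := fun s hs => ⟨hs.1, hs.2.trans hb0.le⟩
    have hsub3 : ∀ s ∈ Set.Ioo T b, s ∈ Set.Ioo T 0 := fun s hs => ⟨hs.1, hs.2.trans hb0⟩
    have key := lt_of_hasDerivAt_neg
      (f := fun t => (H t)⁻¹ - (1 - 3 * β ^ 3 * t) / gammaβ β)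
      (f' := fun t => -(H t ^ 2 * h t) / H t ^ 2 - (-(3 * β ^ 3)) / gammaβ β)
      (((S.contH.mono hsub2).inv₀ (fun s hs => (S.H_pos s (hsub2 hs)).ne')).sub (by fun_prop))
      (fun s hs => ((S.derivH s (hsub3 s hs)).inv (S.Ho (hsub3 s hs)).ne').sub
        ((hasDerivAt_r β s).div_const _)) ?_
      (t := t) ⟨ht.1, htb⟩
    · linarith
    · intro s hs
      have hs' := hsub3 s hs
      have hH := S.Ho hs'
      have hu2 := lt_of_hasDerivAt_neg (S.cont_u.mono hsub2)
        (fun x hx => S.deriv_u (hsub3 x hx)) (fun x hx => S.deriv_u_neg (hsub3 x hx)) hs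
      simp only [hb2] at hu2
      have hh := (S.rel s hs').le_h
      have e : -(H s ^ 2 * h s) / H s ^ 2 = -h s := by field_simp
      have h3 : 3 * β ^ 3 / gammaβ β < 1 := by
        rw [div_lt_one (by linarith)]
        have : β ^ 3 < (1 / 2) ^ 3 := pow_lt_pow_left₀ S.β_lt hb.le (by norm_num)
        linarith
      rw [e, neg_div]
      linarith
  have h1 := S.one_lt_r ht
  have hH := S.Ho ht
  rw [div_lt_iff₀ (by linarith), inv_mul_eq_div, lt_div_iff₀ hH] at main
  rw [lt_div_iff₀ (by linarith)]
  linarith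

lemma lt_exp_mul (S : PastSolution T β H φ p h) {t : ℝ} (ht : t ∈ Set.Ioo T 0) :
    β - thetaβ β * t < Real.exp (φ t) * H t := by
  have key := lt_of_hasDerivAt_neg (f := fun t => Real.exp (φ t) * H t + thetaβ β * t)
    (f' := fun t => (Real.exp (φ t) * (-(H t * p t)) * H t +
      Real.exp (φ t) * (H t ^ 2 * h t)) + thetaβ β)
    ((S.contφ.rexp.mul S.contH).add (by fun_prop))
    (fun s hs => ((S.derivφ s hs).exp.mul (S.derivH s hs)).add
      (by simpa using (hasDerivAt_id s).const_mul (thetaβ β))) ?_ ht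
  · simp only [S.φ_zero, S.H_zero, Real.exp_zero, mul_zero, add_zero, one_mul] at key
    linarith
  · intro s hs
    have R := S.rel s hs
    have h1 := S.lt_u hs
    have h2 := thetaβ_lt S.β_pos S.β_lt
    have h3 : 1 < p s - h s := by linarith [R.two_lt, R.two_mul_lt]
    have := mul_lt_mul_of_pos_left h3 R.u_pos
    nlinarith

lemma Hupper_left_pos (S : PastSolution T β H φ p h) {t : ℝ} (ht : t < 0) :
    0 < Real.exp (6 * gammaβ β * t) *
        (1 / β ^ 2 - 4 * β / (5 * gammaβ β) + 2 * thetaβ β / (15 * (gammaβ β) ^ 2)) -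
      2 * (-6 * β * gammaβ β + thetaβ β + 6 * gammaβ β * thetaβ β * t) /
        (15 * (gammaβ β) ^ 2) := by
  have hb := S.β_pos
  have hb' := S.β_lt
  have hg := three_half_lt_gammaβ hb
  have hθ := thetaβ_nonneg hb
  have hθ' := thetaβ_lt hb hb'
  have h1 : 1 < 1 / β ^ 2 := by
    rw [lt_div_iff₀ (by positivity)]
    nlinarith
  have h2 : 4 * β / (5 * gammaβ β) < 1 := by
    rw [div_lt_one (by positivity)]
    linarith
  have h3 : 0 ≤ 2 * thetaβ β / (15 * (gammaβ β) ^ 2) := by positivity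
  have h4 : 0 ≤ -(2 * (-6 * β * gammaβ β + thetaβ β + 6 * gammaβ β * thetaβ β * t)) /
        (15 * (gammaβ β) ^ 2) := by
    refine div_nonneg ?_ (by positivity)
    have : 0 ≤ gammaβ β * thetaβ β * (-t) :=
      mul_nonneg (mul_nonneg (by linarith) hθ) (by linarith)
    nlinarith
  have h5 := mul_pos (Real.exp_pos (6 * gammaβ β * t))
    (show 0 < 1 / β ^ 2 - 4 * β / (5 * gammaβ β) + 2 * thetaβ β / (15 * (gammaβ β) ^ 2) by
      linarith)
  rw [neg_div] at h4
  linarith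

lemma Hupper_left_lt (S : PastSolution T β H φ p h) {t : ℝ} (ht : t ∈ Set.Ioo T 0) :
    Real.exp (6 * gammaβ β * t) *
        (1 / β ^ 2 - 4 * β / (5 * gammaβ β) + 2 * thetaβ β / (15 * (gammaβ β) ^ 2)) -
      2 * (-6 * β * gammaβ β + thetaβ β + 6 * gammaβ β * thetaβ β * t) /
        (15 * (gammaβ β) ^ 2) < (H t ^ 2)⁻¹ := by
  have hb := S.β_pos
  have hg := three_half_lt_gammaβ hb
  have hg0 : gammaβ β ≠ 0 := by positivity
  set γ := gammaβ β with hγ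
  set θ := thetaβ β with hθ
  have key := lt_of_hasDerivAt_neg
    (f := fun t => Real.exp (-(6 * γ) * t) *
      ((H t ^ 2)⁻¹ + 2 / (15 * γ ^ 2) * (-6 * β * γ + θ + 6 * γ * θ * t)))
    (f' := fun t => Real.exp (-(6 * γ) * t) * (-(6 * γ)) *
        ((H t ^ 2)⁻¹ + 2 / (15 * γ ^ 2) * (-6 * β * γ + θ + 6 * γ * θ * t)) +
      Real.exp (-(6 * γ) * t) * (-(2 * H t * (H t ^ 2 * h t)) / (H t ^ 2) ^ 2 +
        2 / (15 * γ ^ 2) * (6 * γ * θ))) ?_ ?_ ?_ ht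
  · have he : Real.exp (6 * γ * t) * Real.exp (-(6 * γ) * t) = 1 := by
      rw [← Real.exp_add]; simp
    have := mul_lt_mul_of_pos_left key (Real.exp_pos (6 * γ * t))
    rw [← mul_assoc (Real.exp (6 * γ * t)) (Real.exp (-(6 * γ) * t)), he] at this
    simp only [S.H_zero, mul_zero, Real.exp_zero, one_mul, add_zero] at this
    have e1 : (β ^ 2)⁻¹ + 2 / (15 * γ ^ 2) * (-6 * β * γ + θ) =
        1 / β ^ 2 - 4 * β / (5 * γ) + 2 * θ / (15 * γ ^ 2) := by
      field_simp
      ring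
    rw [e1] at this
    have e2 : 2 * (-6 * β * γ + θ + 6 * γ * θ * t) / (15 * γ ^ 2) =
      2 / (15 * γ ^ 2) * (-6 * β * γ + θ + 6 * γ * θ * t) := by ring
    rw [e2]
    linarith
  · refine ContinuousOn.mul (by fun_prop) (ContinuousOn.add ?_ (by fun_prop))
    exact (S.contH.pow 2).inv₀ (fun s hs => (pow_pos (S.H_pos s hs) 2).ne')
  · intro s hs
    have hH := S.Ho hs
    have d1 : HasDerivAt (fun t => Real.exp (-(6 * γ) * t))
        (Real.exp (-(6 * γ) * s) * (-(6 * γ))) s := by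
      simpa using ((hasDerivAt_id s).const_mul (-(6 * γ))).exp
    have d2 : HasDerivAt (fun t => (H t ^ 2)⁻¹)
        (-(2 * H s * (H s ^ 2 * h s)) / (H s ^ 2) ^ 2) s := by
      have := ((S.derivH s hs).pow 2).inv (pow_pos hH 2).ne'
      rw [show -(2 * H s * (H s ^ 2 * h s)) = -((2 : ℕ) * H s ^ (2 - 1) * (H s ^ 2 * h s)) by
        push_cast; ring]
      exact this
    have d3 : HasDerivAt (fun t => 2 / (15 * γ ^ 2) * (-6 * β * γ + θ + 6 * γ * θ * t))
        (2 / (15 * γ ^ 2) * (6 * γ * θ)) s := by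
      simpa using (((hasDerivAt_id s).const_mul (6 * γ * θ)).const_add
        (-6 * β * γ + θ)).const_mul (2 / (15 * γ ^ 2))
    exact d1.mul (d2.add d3)
  · intro s hs
    have hH := S.Ho hs
    have hR := S.one_lt_r hs
    have R := S.rel s hs
    have hlt : H s < γ := (S.H_lt hs).trans_le (div_le_self (by linarith) hR.le)
    have hEH := S.lt_exp_mul hs
    have e : Real.exp (-(6 * γ) * s) * (-(6 * γ)) *
        ((H s ^ 2)⁻¹ + 2 / (15 * γ ^ 2) * (-6 * β * γ + θ + 6 * γ * θ * s)) +
      Real.exp (-(6 * γ) * s) * (-(2 * H s * (H s ^ 2 * h s)) / (H s ^ 2) ^ 2 +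
        2 / (15 * γ ^ 2) * (6 * γ * θ)) =
      Real.exp (-(6 * γ) * s) * (2 / H s ^ 2) *
        (12 / 5 * (β - θ * s) * H s ^ 2 - h s * H s - 3 * γ) := by
      field_simp
      ring
    rw [e]
    refine mul_neg_of_pos_of_neg (by positivity) ?_
    have h1 := mul_le_mul_of_nonneg_right R.le_h hH.le
    have h2 := mul_lt_mul_of_pos_right hEH (pow_pos hH 2)
    nlinarith

lemma lt_Hupper (S : PastSolution T β H φ p h) {t : ℝ} (ht : t ∈ Set.Ioo T 0) :
    H t < Hupper β t := by
  refine lt_min ?_ (S.H_lt ht)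
  have hH := S.Ho ht
  have h1 := Real.rpow_lt_rpow_of_neg (S.Hupper_left_pos ht.2) (S.Hupper_left_lt ht)
    (show (-(1 / 2) : ℝ) < 0 by norm_num)
  have e : ((H t ^ 2)⁻¹) ^ (-(1 / 2) : ℝ) = H t := by
    rw [Real.inv_rpow (by positivity), Real.rpow_neg (by positivity), inv_inv,
      ← Real.sqrt_eq_rpow, Real.sqrt_sq hH.le]
  rwa [e] at h1

lemma r_pos (S : PastSolution T β H φ p h) {t : ℝ} (ht : t ∈ Set.Ioc T 0) :
    0 < 1 - 3 * β ^ 3 * t := by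
  have := mul_nonneg (pow_pos S.β_pos 3).le (neg_nonneg.2 ht.2)
  linarith

/-- If `p - c h ≤ 3 β³ k / γ` along the solution then `e^φ H^c` grows at most like
`(1 - 3 β³ t)^k` into the past. -/
lemma log_bound (S : PastSolution T β H φ p h) {c k : ℝ} (hk : 0 < k)
    (hck : ∀ s ∈ Set.Ioo T 0, p s - c * h s ≤ 3 * β ^ 3 * k / gammaβ β)
    {t : ℝ} (ht : t ∈ Set.Ioo T 0) :
    φ t + c * Real.log (H t) < c * Real.log β + k * Real.log (1 - 3 * β ^ 3 * t) := by
  have hb := S.β_pos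
  have hg := three_half_lt_gammaβ hb
  have key := lt_of_hasDerivAt_pos
    (f := fun t => φ t + c * Real.log (H t) - k * Real.log (1 - 3 * β ^ 3 * t))
    (f' := fun t => -(H t * p t) + c * (H t ^ 2 * h t / H t) -
      k * (-(3 * β ^ 3) / (1 - 3 * β ^ 3 * t)))
    ?_ ?_ ?_ ht
  · simp only [S.φ_zero, S.H_zero, mul_zero, sub_zero, Real.log_one, zero_add] at key
    linarith
  · refine (S.contφ.add ((S.contH.log fun s hs => (S.H_pos s hs).ne').const_mul c)).sub
      (ContinuousOn.const_mul (ContinuousOn.log (by fun_prop) fun s hs => (S.r_pos hs).ne') k)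
  · intro s hs
    exact ((S.derivφ s hs).add (((S.derivH s hs).log (S.Ho hs).ne').const_mul c)).sub
      (((hasDerivAt_r β s).log (by linarith [S.one_lt_r hs])).const_mul k)
  · intro s hs
    have hH := S.Ho hs
    have hr := S.one_lt_r hs
    have h1 : H s / gammaβ β < 1 / (1 - 3 * β ^ 3 * s) := by
      have := S.H_lt hs
      rw [lt_div_iff₀ (by linarith)] at this
      rw [div_lt_div_iff₀ (by linarith) (by linarith)]
      linarith
    have h2 := mul_lt_mul_of_pos_left h1 (show 0 < 3 * β ^ 3 * k by positivity)
    have h3 := mul_le_mul_of_nonneg_left (hck s hs) hH.le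
    have e1 : H s ^ 2 * h s / H s = H s * h s := by field_simp
    have e2 : k * (-(3 * β ^ 3) / (1 - 3 * β ^ 3 * s)) =
      -(3 * β ^ 3 * k * (1 / (1 - 3 * β ^ 3 * s))) := by ring
    have e3 : H s * (3 * β ^ 3 * k / gammaβ β) = 3 * β ^ 3 * k * (H s / gammaβ β) := by ring
    rw [e1, e2]
    rw [e3] at h3
    nlinarith

/-- Exponentiated form of `log_bound`. -/
lemma rpow_bound (S : PastSolution T β H φ p h) {c k : ℝ} (hk : 0 < k)
    (hck : ∀ s ∈ Set.Ioo T 0, p s - c * h s ≤ 3 * β ^ 3 * k / gammaβ β)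
    {t : ℝ} (ht : t ∈ Set.Ioo T 0) :
    Real.exp (φ t) * H t ^ c < β ^ c * (1 - 3 * β ^ 3 * t) ^ k := by
  have := Real.exp_lt_exp.2 (S.log_bound hk hck ht)
  rw [Real.exp_add, Real.exp_add] at this
  rw [Real.rpow_def_of_pos (S.Ho ht), Real.rpow_def_of_pos S.β_pos,
    Real.rpow_def_of_pos (S.r_pos ⟨ht.1, ht.2.le⟩)]
  simpa only [mul_comm] using this

lemma rpow_bound_mβ (S : PastSolution T β H φ p h) {t : ℝ} (ht : t ∈ Set.Ioo T 0) :
    Real.exp (φ t) * H t ^ (11 / 4 : ℝ) < β ^ (11 / 4 : ℝ) * (1 - 3 * β ^ 3 * t) ^ mβ β := by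
  refine S.rpow_bound (mβ_pos S.β_pos) (fun s hs => ?_) ht
  have hb := S.β_pos
  have hb' := S.β_lt
  have hg := three_half_lt_gammaβ hb
  have h1 := (S.rel s hs).sub_le
  have h2 := S.lt_u hs
  rw [mβ_eq hb, le_div_iff₀ (by linarith)]
  have h3 : p s - 11 / 4 * h s ≤ 107 / 10 - 3 / 5 * β ^ 2 := by linarith
  have h4 := mul_le_mul_of_nonneg_right h3 (show 0 ≤ gammaβ β by linarith)
  have h5 : β ^ 3 ≤ β ^ 2 * gammaβ β := by nlinarith [pow_pos hb 2]
  linarith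

lemma Hlower_base_pos (hb : 0 < β) {t : ℝ} (ht : t ≤ 0) :
    0 < β ^ (-(1 / 4) : ℝ) - β ^ (-(1 / 4) : ℝ) / (4 * (mβ β + 1)) *
        (1 - (1 - 3 * β ^ 3 * t) ^ (mβ β + 1)) := by
  have hm := mβ_pos hb
  have hr : 1 ≤ 1 - 3 * β ^ 3 * t := by
    have := mul_nonneg (pow_pos hb 3).le (neg_nonneg.2 ht)
    linarith
  have h1 := Real.one_le_rpow hr (show 0 ≤ mβ β + 1 by linarith)
  have h2 : 0 < β ^ (-(1 / 4) : ℝ) := by positivity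
  have h3 : 0 < β ^ (-(1 / 4) : ℝ) / (4 * (mβ β + 1)) := by positivity
  nlinarith

lemma Hlower_pos (hb : 0 < β) {t : ℝ} (ht : t ≤ 0) : 0 < Hlower β t :=
  Real.rpow_pos_of_pos (Hlower_base_pos hb ht) _

lemma Hlower_lt (S : PastSolution T β H φ p h) {t : ℝ} (ht : t ∈ Set.Ioo T 0) :
    Hlower β t < H t := by
  have hb := S.β_pos
  have hm := mβ_pos hb
  set q := β ^ (-(1 / 4) : ℝ) with hq
  have key := lt_of_hasDerivAt_pos
    (f := fun t => H t ^ (-(1 / 4) : ℝ) - (q - q / (4 * (mβ β + 1)) *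
        (1 - (1 - 3 * β ^ 3 * t) ^ (mβ β + 1))))
    (f' := fun t => H t ^ 2 * h t * (-(1 / 4)) * H t ^ ((-(1 / 4) : ℝ) - 1) -
      (-(q / (4 * (mβ β + 1)) *
        (-((-(3 * β ^ 3)) * (mβ β + 1) * (1 - 3 * β ^ 3 * t) ^ (mβ β + 1 - 1))))))
    ?_ ?_ ?_ ht
  · simp only [S.H_zero, mul_zero, sub_zero, Real.one_rpow, sub_self] at key
    have hlt := sub_neg.1 (key.trans_eq (by rw [hq]; ring))
    have hH := S.Ho ht
    have := Real.rpow_lt_rpow_of_neg (by positivity : 0 < H t ^ (-(1 / 4) : ℝ)) hlt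
      (show (-4 : ℝ) < 0 by norm_num)
    rw [← Real.rpow_mul hH.le] at this
    norm_num at this
    unfold Hlower
    norm_num [hq] at this ⊢
    exact this
  · refine ContinuousOn.sub (S.contH.rpow_const fun s hs => Or.inl (S.H_pos s hs).ne') ?_
    refine continuousOn_const.sub (continuousOn_const.mul (continuousOn_const.sub ?_))
    exact ContinuousOn.rpow_const (by fun_prop) fun s hs => Or.inl (S.r_pos hs).ne'
  · intro s hs
    have hr := S.one_lt_r hs
    exact ((S.derivH s hs).rpow_const (Or.inl (S.Ho hs).ne')).sub
      (((((hasDerivAt_r β s).rpow_const (p := mβ β + 1) (Or.inl (by linarith))).const_sub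
        1).const_mul (q / (4 * (mβ β + 1)))).const_sub q)
  · intro s hs
    have hH := S.Ho hs
    have hr := S.one_lt_r hs
    have R := S.rel s hs
    have h1 := S.rpow_bound_mβ hs
    have e1 : H s ^ 2 * H s ^ ((-(1 / 4) : ℝ) - 1) = H s ^ (3 / 4 : ℝ) := by
      rw [← Real.rpow_natCast, ← Real.rpow_add hH]; norm_num
    have e2 : H s ^ (3 / 4 : ℝ) * H s ^ 2 = H s ^ (11 / 4 : ℝ) := by
      rw [← Real.rpow_natCast, ← Real.rpow_add hH]; norm_num
    have e3 : q * β ^ 3 = β ^ (11 / 4 : ℝ) := by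
      rw [hq, ← Real.rpow_natCast, ← Real.rpow_add hb]; norm_num
    have e4 : mβ β + 1 - 1 = mβ β := by ring
    rw [e4]
    have h2 := mul_le_mul_of_nonneg_left R.h_le (by positivity : 0 ≤ H s ^ (3 / 4 : ℝ))
    have e5 : H s ^ (3 / 4 : ℝ) * (12 / 5 * (Real.exp (φ s) * H s ^ 2)) =
        12 / 5 * (Real.exp (φ s) * H s ^ (11 / 4 : ℝ)) := by rw [← e2]; ring
    have e6 : H s ^ 2 * h s * (-(1 / 4)) * H s ^ ((-(1 / 4) : ℝ) - 1) -
      (-(q / (4 * (mβ β + 1)) *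
        (-((-(3 * β ^ 3)) * (mβ β + 1) * (1 - 3 * β ^ 3 * s) ^ mβ β)))) =
      1 / 4 * (3 * (β ^ (11 / 4 : ℝ) * (1 - 3 * β ^ 3 * s) ^ mβ β) -
        H s ^ (3 / 4 : ℝ) * h s) := by
      rw [← e1, ← e3]
      field_simp
      ring
    rw [e6]
    rw [e5] at h2
    have : 0 < β ^ (11 / 4 : ℝ) * (1 - 3 * β ^ 3 * s) ^ mβ β := by positivity
    linarith

lemma exp_mul_cube_lt (S : PastSolution T β H φ p h) {t : ℝ} (ht : t ∈ Set.Ioo T 0) :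
    Real.exp (φ t) * H t ^ 3 < β ^ 3 * (1 - 3 * β ^ 3 * t) ^ (4 * gammaβ β / β ^ 3) := by
  have hb := S.β_pos
  have hg := three_half_lt_gammaβ hb
  have := S.rpow_bound (c := 3) (k := 4 * gammaβ β / β ^ 3) (by positivity) ?_ ht
  · exact_mod_cast this
  · intro s hs
    have R := S.rel s hs
    have e : 3 * β ^ 3 * (4 * gammaβ β / β ^ 3) / gammaβ β = 12 := by
      have : gammaβ β ≠ 0 := by positivity
      field_simp
      norm_num
    rw [e]
    linarith [R.sub_le, R.le_h, R.u_pos]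

lemma lt_phiupper (S : PastSolution T β H φ p h) {t : ℝ} (ht : t ∈ Set.Ioo T 0) :
    φ t < phiupper β t := by
  have hb := S.β_pos
  have hg := three_half_lt_gammaβ hb
  set k := (4 * gammaβ β + β ^ 3) / β ^ 3 with hk
  have key := lt_of_hasDerivAt_pos (f := fun t => φ t - phiupper β t)
    (f' := fun t => -(H t * p t) - (√6 * gammaβ β / (3 * β ^ 3) *
        (-(3 * β ^ 3) / (1 - 3 * β ^ 3 * t)) + 2 * β ^ 3 / (4 * gammaβ β + β ^ 3) *
        (-(3 * β ^ 3) * k * (1 - 3 * β ^ 3 * t) ^ (k - 1))))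
    ?_ ?_ ?_ ht
  · simp only [phiupper, S.φ_zero, mul_zero, sub_zero, Real.log_one, Real.one_rpow, sub_self,
      add_zero] at key
    exact sub_neg.1 key
  · refine S.contφ.sub (ContinuousOn.add (continuousOn_const.mul ?_)
      (continuousOn_const.mul (ContinuousOn.sub ?_ continuousOn_const)))
    · exact ContinuousOn.log (by fun_prop) fun s hs => (S.r_pos hs).ne'
    · exact ContinuousOn.rpow_const (by fun_prop) fun s hs => Or.inl (S.r_pos hs).ne'
  · intro s hs
    have hr := S.one_lt_r hs
    exact (S.derivφ s hs).sub ((((hasDerivAt_r β s).log (by linarith)).const_mul _).add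
      ((((hasDerivAt_r β s).rpow_const (p := k) (Or.inl (by linarith))).sub_const 1).const_mul _))
  · intro s hs
    have hH := S.Ho hs
    have hr := S.one_lt_r hs
    have hr0 : 1 - 3 * β ^ 3 * s ≠ 0 := by linarith
    have R := S.rel s hs
    have h1 := S.exp_mul_cube_lt hs
    have h2 := mul_lt_mul_of_pos_left (S.H_lt hs) (show 0 < √6 by positivity)
    have h3 := mul_lt_mul_of_pos_left R.lt_add_sqrt hH
    have ek : k - 1 = 4 * gammaβ β / β ^ 3 := by rw [hk]; field_simp; ring
    have e1 : √6 * gammaβ β / (3 * β ^ 3) * (-(3 * β ^ 3) / (1 - 3 * β ^ 3 * s)) =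
        -(√6 * (gammaβ β / (1 - 3 * β ^ 3 * s))) := by
      field_simp
    have e2 : 2 * β ^ 3 / (4 * gammaβ β + β ^ 3) *
        (-(3 * β ^ 3) * k * (1 - 3 * β ^ 3 * s) ^ (k - 1)) =
        -(6 * (β ^ 3 * (1 - 3 * β ^ 3 * s) ^ (4 * gammaβ β / β ^ 3))) := by
      rw [ek, hk]
      have : 4 * gammaβ β + β ^ 3 ≠ 0 := by positivity
      generalize (1 - 3 * β ^ 3 * s) ^ (4 * gammaβ β / β ^ 3) = X
      field_simp
      ring
    rw [e1, e2]
    nlinarith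

end PastSolution

/-- The relations between `e^φ H²`, `-φ'/H` and `H'/H²` obtained by differentiating the
Hamiltonian constraint. -/
lemma negBranchRel_of_constraint {H P B A E : ℝ} (hH : 0 < H) (hP : P < 0) (hE : 0 < E)
    (hcon : 3 * H ^ 2 - 3 * E * P * H ^ 3 = P ^ 2 / 2)
    (hdcon : 6 * H * A - 3 * (E * P ^ 2 * H ^ 3 + E * B * H ^ 3 + 3 * E * P * H ^ 2 * A) = P * B)
    (hB : B = -3 * H * P - 3 * E * H ^ 2 * (H ^ 2 + A)) :
    NegBranchRel (E * H ^ 2) (-P / H) (A / H ^ 2) := by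
  have hp : 0 < -P / H := div_pos (neg_pos.2 hP) hH
  obtain ⟨p, rfl⟩ : ∃ p, P = -(H * p) := ⟨-P / H, by field_simp⟩
  obtain ⟨h, rfl⟩ : ∃ h, A = H ^ 2 * h := ⟨A / H ^ 2, by field_simp⟩
  have e1 : -(-(H * p)) / H = p := by field_simp
  have e2 : H ^ 2 * h / H ^ 2 = h := by field_simp
  rw [e1] at hp
  rw [e1, e2]
  have hsq : p ^ 2 = 6 * (E * H ^ 2) * p + 6 := by
    have : H ^ 2 * (p ^ 2 - (6 * (E * H ^ 2) * p + 6)) = 0 := by linear_combination -2 * hcon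
    have := (mul_eq_zero.1 this).resolve_left (by positivity)
    linarith
  refine ⟨by positivity, hp, hsq, ?_⟩
  subst hB
  have h1 : H ^ 3 * ((h * (2 + 2 * (E * H ^ 2) * p + 3 * (E * H ^ 2) ^ 2)) -
      (6 * (E * H ^ 2) ^ 2 * p + 6 * (E * H ^ 2) - 3 * (E * H ^ 2) ^ 2
        - 2 * (E * H ^ 2) * p - 6)) = 0 := by
    linear_combination hdcon / 3 + H ^ 3 * (E * H ^ 2 - 1) * hsq
  have := (mul_eq_zero.1 h1).resolve_left (by positivity)
  linarith

/-- A solution of the EdGB system with negative-branch data and `H > 0` on `(T, 0]`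
satisfies the reduced system there. -/
lemma exists_pastSolution {a : EReal} {β T : ℝ} {H φ : ℝ → ℝ}
    (hsys : EdGB H φ {t : ℝ | a < (t : EReal) ∧ t ≤ 0}) (hdata : NegBranchData H φ β)
    (haT : a ≤ (T : EReal)) (hpos : ∀ t ∈ Set.Ioc T 0, 0 < H t) :
    ∃ p h, PastSolution T β H φ p h := by
  obtain ⟨cH, cφ, hcon, hB⟩ := hsys
  obtain ⟨hb, hb', hH0, hφ0, hdφ0⟩ := hdata
  have hsub : Set.Ioc T 0 ⊆ {t : ℝ | a < (t : EReal) ∧ t ≤ 0} := fun t ht =>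
    ⟨haT.trans_lt (EReal.coe_lt_coe_iff.2 ht.1), ht.2⟩
  have cH' := cH.mono hsub
  have cφ' := cφ.mono hsub
  have hnhds : ∀ t ∈ Set.Ioo T 0, Set.Ioc T 0 ∈ nhds t := fun t ht =>
    Filter.mem_of_superset (isOpen_Ioo.mem_nhds ht) Set.Ioo_subset_Ioc_self
  have dH : ∀ t ∈ Set.Ioo T 0, HasDerivAt H (deriv H t) t := fun t ht =>
    ((cH'.contDiffAt (hnhds t ht)).differentiableAt (by norm_num)).hasDerivAt
  have dφ : ∀ t ∈ Set.Ioo T 0, HasDerivAt φ (deriv φ t) t := fun t ht =>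
    ((cφ'.contDiffAt (hnhds t ht)).differentiableAt (by norm_num)).hasDerivAt
  have ddφ : ∀ t ∈ Set.Ioo T 0, HasDerivAt (deriv φ) (deriv (deriv φ) t) t := by
    intro t ht
    have h1 : ContDiffOn ℝ 1 (deriv φ) (Set.Ioo T 0) :=
      (cφ'.mono Set.Ioo_subset_Ioc_self).deriv_of_isOpen isOpen_Ioo (by norm_num)
    exact ((h1.contDiffAt (isOpen_Ioo.mem_nhds ht)).differentiableAt (by norm_num)).hasDerivAt
  have hd0 : deriv φ 0 < 0 := by
    rw [hdφ0]
    have := pow_pos hb 3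
    have := Real.sqrt_nonneg (9 * β ^ 6 + 6 * β ^ 2)
    linarith
  have contD : ContinuousOn (deriv φ) (Set.Ioc T 0) := by
    refine (cφ'.continuousOn_derivWithin (uniqueDiffOn_Ioc T 0) (by norm_num)).congr ?_
    intro t ht
    have hdiff : DifferentiableAt ℝ φ t := by
      rcases ht.2.lt_or_eq with h | h
      · exact (dφ t ⟨ht.1, h⟩).differentiableAt
      · exact differentiableAt_of_deriv_ne_zero (by rw [h]; exact hd0.ne)
    exact (hdiff.derivWithin (uniqueDiffOn_Ioc T 0 t ht)).symm
  have dneg : ∀ t ∈ Set.Ioc T 0, deriv φ t < 0 := by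
    intro t ht
    by_contra! hge
    have hsub' : Set.Icc t 0 ⊆ Set.Ioc T 0 := fun s hs => ⟨ht.1.trans_le hs.1, hs.2⟩
    obtain ⟨b, hb1, hb2⟩ := intermediate_value_Icc' ht.2 (contD.mono hsub') ⟨hd0.le, hge⟩
    have h1 := hcon b (hsub (hsub' hb1))
    have h2 := hpos b (hsub' hb1)
    rw [hb2] at h1
    nlinarith [pow_pos h2 2]
  refine ⟨fun t => -deriv φ t / H t, fun t => deriv H t / H t ^ 2, hb, lt_half_of_lt_sqrt hb',
    cH'.continuousOn, cφ'.continuousOn, hpos, hH0, hφ0, ?_, ?_, ?_⟩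
  · intro t ht
    have := hpos t ⟨ht.1, ht.2.le⟩
    convert dφ t ht using 1
    field_simp
  · intro t ht
    have := hpos t ⟨ht.1, ht.2.le⟩
    convert dH t ht using 1
    field_simp
  · intro t ht
    have ht' : t ∈ Set.Ioc T 0 := ⟨ht.1, ht.2.le⟩
    have d1 := (((dH t ht).pow 2).const_mul 3).sub
      (((((dφ t ht).exp.const_mul 3).mul (ddφ t ht)).mul ((dH t ht).pow 3)).add
        (((ddφ t ht).pow 2).div_const 2))
    have d2 : HasDerivAt (fun _ : ℝ => (0 : ℝ)) 0 t := hasDerivAt_const t 0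
    have hev : (fun _ : ℝ => (0 : ℝ)) =ᶠ[nhds t] fun s => 3 * H s ^ 2 -
        (3 * Real.exp (φ s) * deriv φ s * H s ^ 3 + deriv φ s ^ 2 / 2) := by
      filter_upwards [hnhds t ht] with s hs
      have := hcon s (hsub hs)
      linarith
    have huniq := (d1.congr_of_eventuallyEq hev).unique d2
    refine negBranchRel_of_constraint (hpos t ht') (dneg t ht') (Real.exp_pos _)
      (hcon t (hsub ht')) ?_ (hB t (hsub ht'))
    simp only [Pi.pow_apply, Pi.mul_apply] at huniq
    push_cast at huniq
    linear_combination huniq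

/-- Positivity of `H` persists throughout the past evolution. -/
lemma EdGB.H_pos {a : EReal} {β : ℝ} {H φ : ℝ → ℝ}
    (hsys : EdGB H φ {t : ℝ | a < (t : EReal) ∧ t ≤ 0}) (hdata : NegBranchData H φ β)
    {t : ℝ} (hat : a < (t : EReal)) (ht : t ≤ 0) : 0 < H t := by
  by_contra! hle
  have hb := hdata.1
  have hH0 : 0 < H 0 := by rw [hdata.2.2.1]; exact hb
  have hsub : Set.Icc t 0 ⊆ {t : ℝ | a < (t : EReal) ∧ t ≤ 0} := fun s hs =>
    ⟨hat.trans_le (EReal.coe_le_coe_iff.2 hs.1), hs.2⟩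
  have cH : ContinuousOn H (Set.Icc t 0) := hsys.1.continuousOn.mono hsub
  have hcomp : IsCompact (Set.Icc t 0 ∩ H ⁻¹' Set.Iic 0) :=
    isCompact_Icc.of_isClosed_subset (cH.preimage_isClosed_of_isClosed isClosed_Icc isClosed_Iic)
      Set.inter_subset_left
  obtain ⟨T, ⟨hT1, hT2⟩, hmax⟩ := hcomp.exists_isGreatest ⟨t, ⟨le_rfl, ht⟩, hle⟩
  have hT0 : T < 0 := by
    refine lt_of_le_of_ne hT1.2 ?_
    rintro rfl
    exact absurd hH0 (not_lt.2 hT2)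
  have hpos : ∀ s ∈ Set.Ioc T 0, 0 < H s := by
    intro s hs
    by_contra! hs'
    exact absurd (hmax ⟨⟨hT1.1.trans hs.1.le, hs.2⟩, hs'⟩) (not_le.2 hs.1)
  obtain ⟨p, h, S⟩ := exists_pastSolution hsys hdata (hsub hT1).1.le hpos
  have hne : (nhdsWithin T (Set.Ioo T 0)).NeBot := by
    rw [nhdsWithin_Ioo_eq_nhdsGT hT0]; infer_instance
  have l1 : Filter.Tendsto H (nhdsWithin T (Set.Ioo T 0)) (nhds (H T)) :=
    (cH T hT1).mono_left (nhdsWithin_mono T fun s hs => ⟨hT1.1.trans hs.1.le, hs.2.le⟩)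
  have l2 : ContinuousAt (Hlower β) T := by
    have hr : 1 - 3 * β ^ 3 * T ≠ 0 := by
      have := mul_pos (pow_pos hb 3) (neg_pos.2 hT0)
      linarith
    refine ContinuousAt.rpow_const ?_ (Or.inl (PastSolution.Hlower_base_pos hb hT0.le).ne')
    refine continuousAt_const.sub (continuousAt_const.mul (continuousAt_const.sub ?_))
    exact ContinuousAt.rpow_const (by fun_prop) (Or.inl hr)
  have := le_of_tendsto_of_tendsto (l2.mono_left nhdsWithin_le_nhds) l1
    (eventually_nhdsWithin_of_forall fun s hs => (S.Hlower_lt hs).le)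
  exact absurd (this.trans hT2) (not_le.2 (PastSolution.Hlower_pos hb hT0.le))

/-- Past-evolution bounds from the negative-branch data: if `(H, φ)` solves the
EdGB FLRW system on `(a, 0]` (with `a ∈ [−∞, 0)`) with the negative-branch
initial data with parameter `β`, then for all `t ∈ (a, 0)`:
`Hlower β t < H t < Hupper β t`, `0 < Hlower β t`, and
`ln((1 − 3β³t)²) < φ(t) < phiupper β t`. -/
theorem stmt_18 (a : EReal) (ha : a < 0) (β : ℝ) (H φ : ℝ → ℝ)
    (hsys : EdGB H φ {t : ℝ | a < (t : EReal) ∧ t ≤ 0})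
    (hdata : NegBranchData H φ β) :
    ∀ t : ℝ, a < (t : EReal) → t < 0 →
      H t < Hupper β t ∧
      (H t > Hlower β t ∧ Hlower β t > 0) ∧
      (Real.log ((1 - 3 * β ^ 3 * t) ^ 2) < φ t ∧ φ t < phiupper β t) := by
  intro t hat ht
  obtain ⟨T, haT, hTt⟩ := EReal.lt_iff_exists_real_btwn.1 hat
  rw [EReal.coe_lt_coe_iff] at hTt
  obtain ⟨p, h, S⟩ := exists_pastSolution hsys hdata haT.le fun s hs =>
    hsys.H_pos hdata (haT.trans (EReal.coe_lt_coe_iff.2 hs.1)) hs.2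
  have htT : t ∈ Set.Ioo T 0 := ⟨hTt, ht⟩
  exact ⟨S.lt_Hupper htT, ⟨S.Hlower_lt htT, PastSolution.Hlower_pos S.β_pos ht.le⟩,
    S.log_lt_φ htT, S.lt_phiupper htT⟩
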